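/- arXiv:2605.25519 — 5 statements merged into one kernel-verified Lean document; each statement's English description precedes it below -/
import Mathlib

section
/- Let A be a Borel subset of ℝ^d, let H : ℝ^d → ℝ² be Borel measurable and injective on A, and let m : ℝ^d → ℝ be Borel measurable. Then for every β ∈ ℝ^d there exists a Borel measurable function λ̃ : ℝ² → ℝ such that m(x) = ⟨x, β⟩ + λ̃(H(x)) for every x ∈ A. -/
open scoped RealInnerProductSpace

/-- **Non-identification under injectivity.** If the two-dimensional index map `H` is
Borel measurable and injective on a Borel set `A`, then for any Borel measurable
outcome regression `m` and any candidate slope `β` there is a Borel measurable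
control function `lam : ℝ² → ℝ` rationalizing `m` on `A`. -/
theorem non_identification_under_injectivity
    (d : ℕ) (A : Set (EuclideanSpace ℝ (Fin d))) (hA : MeasurableSet A)
    (H : EuclideanSpace ℝ (Fin d) → ℝ × ℝ) (hH : Measurable H)
    (hinj : Set.InjOn H A)
    (m : EuclideanSpace ℝ (Fin d) → ℝ) (hm : Measurable m)
    (β : EuclideanSpace ℝ (Fin d)) :
    ∃ lam : ℝ × ℝ → ℝ, Measurable lam ∧ ∀ x ∈ A, m x = ⟪x, β⟫ + lam (H x) := by
  have : StandardBorelSpace A := hA.standardBorel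
  have hemb : MeasurableEmbedding (A.domRestrict H) :=
    (hH.comp measurable_subtype_coe).measurableEmbedding (Set.injOn_iff_injective.mp hinj)
  have hres : Measurable fun x : A => m x - ⟪(x : EuclideanSpace ℝ (Fin d)), β⟫ := by
    fun_prop
  obtain ⟨lam, hlam, hcomp⟩ := hemb.exists_measurable_extend hres fun _ => inferInstance
  refine ⟨lam, hlam, fun x hx => ?_⟩
  have hx' : lam (H x) = m x - ⟪x, β⟫ := congr_fun hcomp ⟨x, hx⟩
  rw [hx', add_sub_cancel]
end

section
/- Let U ⊆ ℝ³ be a nonempty open connected set, let h₁, h₂ : U → ℝ be continuously differentiable, and set H(x) = (h₁(x), h₂(x)). Assume: (i) the gradients ∇h₁(x) and ∇h₂(x) are linearly independent for every x ∈ U; (ii) there exist points x⁽¹⁾, x⁽²⁾, x⁽³⁾ ∈ U such that the three cross products a(x⁽ᵗ⁾) := ∇h₁(x⁽ᵗ⁾) × ∇h₂(x⁽ᵗ⁾) are linearly independent in ℝ³. Let β₀, β ∈ ℝ³ and let λ₀, λ : ℝ² → ℝ be continuously differentiable on an open set containing H(U). If ⟨x, β₀⟩ + λ₀(H(x)) =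 ⟨x, β⟩ + λ(H(x)) for all x ∈ U, then β = β₀ and λ(s) = λ₀(s) for every s ∈ H(U). -/
open scoped RealInnerProductSpace

/-- A vector orthogonal to every member of a linearly independent family of `n` vectors
in `ℝⁿ` vanishes. -/
theorem eq_zero_of_linearIndependent_of_dotProduct_eq_zero {n : Type*} [Fintype n]
    {A : n → n → ℝ} (hA : LinearIndependent ℝ A) {w : n → ℝ} (hw : ∀ i, A i ⬝ᵥ w = 0) :
    w = 0 := by
  classical
  have hu : IsUnit (Matrix.of A) := Matrix.linearIndependent_rows_iff_isUnit.1 hA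
  exact Matrix.eq_zero_of_mulVec_eq_zero ((Matrix.isUnit_iff_isUnit_det _).1 hu).ne_zero
    (funext hw)

/-- If a linear functional `⟪·, w⟫` factors locally through `(h₁, h₂)` by a differentiable map,
then `w` is a linear combination of the gradients of `h₁` and `h₂`. -/
theorem exists_eq_smul_gradient_add_smul_gradient {E : Type*} [NormedAddCommGroup E]
    [InnerProductSpace ℝ E] [CompleteSpace E] {h₁ h₂ : E → ℝ} {g : ℝ × ℝ → ℝ} {w x : E}
    (hh₁ : DifferentiableAt ℝ h₁ x) (hh₂ : DifferentiableAt ℝ h₂ x)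
    (hg : DifferentiableAt ℝ g (h₁ x, h₂ x))
    (h : (fun y => ⟪w, y⟫) =ᶠ[nhds x] fun y => g (h₁ y, h₂ y)) :
    ∃ c₁ c₂ : ℝ, w = c₁ • gradient h₁ x + c₂ • gradient h₂ x := by
  have hcomp : HasFDerivAt (fun y => g (h₁ y, h₂ y)) _ x :=
    hg.hasFDerivAt.comp x
      (hh₁.hasGradientAt.hasFDerivAt.prodMk hh₂.hasGradientAt.hasFDerivAt)
  have hD := ((innerSL ℝ w).hasFDerivAt (x := x)).unique (hcomp.congr_of_eventuallyEq h)
  set L := fderiv ℝ g (h₁ x, h₂ x)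
  refine ⟨L (1, 0), L (0, 1), ext_inner_right ℝ fun v => ?_⟩
  have hv := DFunLike.congr_fun hD v
  have hL : ∀ p q : ℝ, L (p, q) = p * L (1, 0) + q * L (0, 1) := fun p q => by
    rw [← smul_eq_mul, ← smul_eq_mul, ← map_smul, ← map_smul, ← map_add]
    simp only [Prod.smul_mk, Prod.mk_add_mk, smul_eq_mul, mul_one, mul_zero, add_zero, zero_add]
  simp only [innerSL_apply_apply, ContinuousLinearMap.comp_apply,
    ContinuousLinearMap.prod_apply, InnerProductSpace.toDual_apply_apply] at hv
  rw [hv, hL, inner_add_left, real_inner_smul_left, real_inner_smul_left]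
  ring

/-- **Identification under nonparametric ordered selection** (analytic core).
On a nonempty open connected `U ⊆ ℝ³`, with `C¹` threshold functions `h₁, h₂`
whose gradients are linearly independent on `U`, and with three points whose
cross-product left-null vectors are linearly independent, the partially linear
representation `x ↦ ⟪x, β⟫ + λ(h₁ x, h₂ x)` identifies both `β` and `λ` on the image. -/
theorem identification_nonparametric_ordered
    (U : Set (EuclideanSpace ℝ (Fin 3)))
    (hUne : U.Nonempty) (hUo : IsOpen U) (hUconn : IsConnected U)
    (h₁ h₂ : EuclideanSpace ℝ (Fin 3) → ℝ)
    (hh₁ : ContDiffOn ℝ 1 h₁ U) (hh₂ : ContDiffOn ℝ 1 h₂ U)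
    (H : EuclideanSpace ℝ (Fin 3) → ℝ × ℝ)
    (hHdef : ∀ x, H x = (h₁ x, h₂ x))
    (hind : ∀ x ∈ U, LinearIndependent ℝ ![gradient h₁ x, gradient h₂ x])
    (a : EuclideanSpace ℝ (Fin 3) → Fin 3 → ℝ)
    (hadef : ∀ x, a x =
      crossProduct ((WithLp.equiv 2 (Fin 3 → ℝ)) (gradient h₁ x))
        ((WithLp.equiv 2 (Fin 3 → ℝ)) (gradient h₂ x)))
    (hspan : ∃ x₁ ∈ U, ∃ x₂ ∈ U, ∃ x₃ ∈ U,
      LinearIndependent ℝ ![a x₁, a x₂, a x₃])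
    (β₀ β : EuclideanSpace ℝ (Fin 3))
    (lam₀ lam : ℝ × ℝ → ℝ)
    (V : Set (ℝ × ℝ)) (hVo : IsOpen V) (hHV : H '' U ⊆ V)
    (hlam₀ : ContDiffOn ℝ 1 lam₀ V) (hlam : ContDiffOn ℝ 1 lam V)
    (heq : ∀ x ∈ U, ⟪x, β₀⟫ + lam₀ (H x) = ⟪x, β⟫ + lam (H x)) :
    β = β₀ ∧ ∀ s ∈ H '' U, lam s = lam₀ s := by
  obtain ⟨x₁, hx₁, x₂, hx₂, x₃, hx₃, hli⟩ := hspan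
  have horth : ∀ x ∈ U, a x ⬝ᵥ (WithLp.equiv 2 (Fin 3 → ℝ)) (β₀ - β) = 0 := by
    intro x hx
    have hU : U ∈ nhds x := hUo.mem_nhds hx
    have hV : V ∈ nhds (h₁ x, h₂ x) := by
      rw [← hHdef]
      exact hVo.mem_nhds (hHV ⟨x, hx, rfl⟩)
    obtain ⟨c₁, c₂, hc⟩ := exists_eq_smul_gradient_add_smul_gradient
      (w := β₀ - β) (g := fun s => lam s - lam₀ s)
      ((hh₁.contDiffAt hU).differentiableAt one_ne_zero)
      ((hh₂.contDiffAt hU).differentiableAt one_ne_zero)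
      (((hlam.contDiffAt hV).differentiableAt one_ne_zero).sub
        ((hlam₀.contDiffAt hV).differentiableAt one_ne_zero))
      (by
        filter_upwards [hU] with y hy
        have := heq y hy
        rw [hHdef] at this
        rw [real_inner_comm, inner_sub_right]
        linarith)
    rw [hadef, hc]
    simp [crossProduct, dotProduct, Fin.sum_univ_three]
    ring
  have hzero : (WithLp.equiv 2 (Fin 3 → ℝ)) (β₀ - β) = 0 := by
    refine eq_zero_of_linearIndependent_of_dotProduct_eq_zero hli fun i => ?_
    fin_cases i
    exacts [horth x₁ hx₁, horth x₂ hx₂, horth x₃ hx₃]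
  have hβ : β = β₀ := by
    ext i
    have := congrFun hzero i
    simp at this
    linarith
  subst hβ
  refine ⟨rfl, ?_⟩
  rintro _ ⟨x, hx, rfl⟩
  exact (add_left_cancel (heq x hx)).symm
end

section
/- Let γ₀, …, γ_K ∈ ℝ^d, let g(x) = log(∑_{j=0}^K exp⟨x, γ_j⟩), and fix v ∈ ℝ^d and x ∈ ℝ^d. If there exist indices j₁, j₂ with ⟨γ_{j₁}, v⟩ ≠ ⟨γ_{j₂}, v⟩, then the function t ↦ g(x + t v) is strictly convex on ℝ. -/
open scoped RealInnerProductSpace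

/-- Strict Jensen inequality for log-sum-exp at two points whose difference is not constant. -/
theorem log_sum_exp_convexCombo_lt {ι : Type*} [Fintype ι] {u w : ι → ℝ} {i j : ι}
    (hij : u i - w i ≠ u j - w j) {a b : ℝ} (ha : 0 < a) (hb : 0 < b) (hab : a + b = 1) :
    Real.log (∑ k, Real.exp (a * u k + b * w k)) <
      a * Real.log (∑ k, Real.exp (u k)) + b * Real.log (∑ k, Real.exp (w k)) := by
  have pos (f : ι → ℝ) : 0 < ∑ k, Real.exp (f k) :=
    Finset.sum_pos (fun k _ => Real.exp_pos _) ⟨i, Finset.mem_univ i⟩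
  have normalized (f : ι → ℝ) :
      ∑ k, Real.exp (f k - Real.log (∑ l, Real.exp (f l))) = 1 := by
    simp_rw [Real.exp_sub, Real.exp_log (pos f), ← Finset.sum_div]
    exact div_self (pos f).ne'
  have hu := normalized u
  have hw := normalized w
  set L := Real.log (∑ k, Real.exp (u k))
  set M := Real.log (∑ k, Real.exp (w k))
  obtain ⟨m, hm⟩ : ∃ m, u m - L ≠ w m - M := by
    by_contra! h
    exact hij (by linarith [h i, h j])
  have key : ∑ k, Real.exp (a * (u k - L) + b * (w k - M)) <
      ∑ k, (a * Real.exp (u k - L) + b * Real.exp (w k - M)) :=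
    Finset.sum_lt_sum
      (fun k _ => convexOn_exp.2 (Set.mem_univ _) (Set.mem_univ _) ha.le hb.le hab)
      ⟨m, Finset.mem_univ m,
        strictConvexOn_exp.2 (Set.mem_univ _) (Set.mem_univ _) hm ha hb hab⟩
  rw [Finset.sum_add_distrib, ← Finset.mul_sum, ← Finset.mul_sum, hu, hw, mul_one, mul_one,
    hab] at key
  have hsplit (k : ι) : a * (u k - L) + b * (w k - M) =
      a * u k + b * w k - (a * L + b * M) := by ring
  simp_rw [hsplit, Real.exp_sub, ← Finset.sum_div] at key
  rw [div_lt_one (Real.exp_pos _)] at key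
  exact (Real.log_lt_iff_lt_exp (pos _)).2 key

/-- **Strict convexity of log-sum-exp along separating directions.** If some two
coefficient vectors are separated by the direction `v` (i.e. `⟪γ j₁, v⟫ ≠ ⟪γ j₂, v⟫`),
then `t ↦ g (x + t v)` is strictly convex on `ℝ`, where
`g(x) = log (∑ j, exp ⟪x, γ j⟫)`. -/
theorem logSumExp_strictConvexOn_of_separating
    (d K : ℕ) (γ : Fin (K + 1) → EuclideanSpace ℝ (Fin d))
    (g : EuclideanSpace ℝ (Fin d) → ℝ)
    (hg : ∀ x, g x = Real.log (∑ j, Real.exp ⟪x, γ j⟫))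
    (x v : EuclideanSpace ℝ (Fin d))
    (hsep : ∃ j₁ j₂ : Fin (K + 1), ⟪γ j₁, v⟫ ≠ ⟪γ j₂, v⟫) :
    StrictConvexOn ℝ Set.univ (fun t : ℝ => g (x + t • v)) := by
  obtain ⟨i, j, hij⟩ := hsep
  refine ⟨convex_univ, fun s _ t _ hst a b ha hb hab => ?_⟩
  have hne : ⟪x + s • v, γ i⟫ - ⟪x + t • v, γ i⟫ ≠ ⟪x + s • v, γ j⟫ - ⟪x + t • v, γ j⟫ := by
    simp only [inner_add_left, real_inner_smul_left, add_sub_add_left_eq_sub, ← sub_mul]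
    rw [real_inner_comm (γ i) v, real_inner_comm (γ j) v]
    exact fun h => hij (mul_left_cancel₀ (sub_ne_zero.2 hst) h)
  have hcombo (k : Fin (K + 1)) : ⟪x + (a • s + b • t) • v, γ k⟫ =
      a * ⟪x + s • v, γ k⟫ + b * ⟪x + t • v, γ k⟫ := by
    simp only [inner_add_left, real_inner_smul_left, smul_eq_mul]
    linear_combination -⟪x, γ k⟫ * hab
  simp only [hg, hcombo]
  exact log_sum_exp_convexCombo_lt (u := fun k => ⟪x + s • v, γ k⟫)
    (w := fun k => ⟪x + t • v, γ k⟫) hne ha hb hab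
end

section
/- Let K ≥ 1, let P ⊆ ℝ^K be compact, and let f : ℝ^K → ℝ be continuous and symmetric, i.e., f(p_{σ(1)}, …, p_{σ(K)}) = f(p₁, …, p_K) for every permutation σ of {1, …, K} and every p ∈ ℝ^K. Then for every ε > 0 there exists a real polynomial Q in K variables such that sup_{p ∈ P} |f(p) − Q(e₁(p), …, e_K(p))| < ε, where e_ℓ denotes the ℓ-th elementary symmetric polynomial in K variables. -/
/-- The multivariate **Weierstrass approximation theorem**. -/
theorem MvPolynomial.exists_near_continuous_of_isCompact {σ : Type*} {s : Set (σ → ℝ)}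
    (hs : IsCompact s) {f : (σ → ℝ) → ℝ} (hf : Continuous f) {ε : ℝ} (hε : 0 < ε) :
    ∃ q : MvPolynomial σ ℝ, ∀ x ∈ s, |f x - MvPolynomial.eval x q| < ε := by
  let coord (i : σ) : C(σ → ℝ, ℝ) := ⟨fun x => x i, continuous_apply i⟩
  have eval_coord (q : MvPolynomial σ ℝ) (x : σ → ℝ) :
      MvPolynomial.aeval coord q x = MvPolynomial.eval x q := by
    induction q using MvPolynomial.induction_on with
    | C a => simp
    | add p q hp hq => simp [hp, hq]
    | mul_X p i hp => simp [hp, coord]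
  have separates : (MvPolynomial.aeval (R := ℝ) coord).range.SeparatesPoints := by
    intro x y hxy
    obtain ⟨i, hi⟩ := Function.ne_iff.mp hxy
    exact ⟨coord i, ⟨coord i, ⟨MvPolynomial.X i, by simp⟩, rfl⟩, hi⟩
  obtain ⟨_, ⟨q, rfl⟩, hq⟩ :=
    ContinuousMap.exists_mem_subalgebra_near_continuous_of_isCompact_of_separatesPoints
      separates ⟨f, hf⟩ hs hε
  refine ⟨q, fun x hx => ?_⟩
  have h := hq x hx
  rw [Real.norm_eq_abs, abs_sub_comm] at h
  simpa [eval_coord] using h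

/-- The average of a polynomial over all permutations of its variables is symmetric. -/
theorem MvPolynomial.isSymmetric_C_mul_sum_rename {σ R : Type*} [Fintype σ] [DecidableEq σ]
    [CommSemiring R] (c : R) (q : MvPolynomial σ R) :
    (C c * ∑ τ : Equiv.Perm σ, rename τ q).IsSymmetric := by
  intro ρ
  simp only [map_mul, rename_C, map_sum, rename_rename]
  congr 1
  exact Fintype.sum_equiv (Equiv.mulLeft ρ) _ _ fun τ => rfl

/-- **Uniform approximation of symmetric functions by polynomials in elementary
symmetric polynomials.** A continuous symmetric function on `ℝ^K` can be uniformly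
approximated on any compact set by a polynomial in the elementary symmetric
polynomials `e₁, …, e_K`. -/
theorem symmetric_continuous_approx_by_esymm_polynomial
    (K : ℕ) (hK : 1 ≤ K) (P : Set (Fin K → ℝ)) (hP : IsCompact P)
    (f : (Fin K → ℝ) → ℝ) (hf : Continuous f)
    (hsym : ∀ (σ : Equiv.Perm (Fin K)) (p : Fin K → ℝ), f (p ∘ σ) = f p)
    (ε : ℝ) (hε : 0 < ε) :
    ∃ Q : MvPolynomial (Fin K) ℝ,
      ∀ p ∈ P,
        |f p - MvPolynomial.eval
            (fun ℓ : Fin K =>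
              MvPolynomial.eval p (MvPolynomial.esymm (Fin K) ℝ ((ℓ : ℕ) + 1))) Q| < ε := by
  let s : Set (Fin K → ℝ) := ⋃ τ : Equiv.Perm (Fin K), (fun p => p ∘ τ) '' P
  have hs : IsCompact s := isCompact_iUnion fun τ => hP.image (by fun_prop)
  obtain ⟨q, hq⟩ := MvPolynomial.exists_near_continuous_of_isCompact hs hf hε
  let c : ℝ := (Fintype.card (Equiv.Perm (Fin K)) : ℝ)⁻¹
  have hcard : (0 : ℝ) < Fintype.card (Equiv.Perm (Fin K)) := by
    exact_mod_cast Fintype.card_pos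
  obtain ⟨Q, hQ⟩ := MvPolynomial.esymmAlgHom_surjective (σ := Fin K) ℝ (n := K) (by simp)
    ⟨_, MvPolynomial.isSymmetric_C_mul_sum_rename c q⟩
  have hQ' := congrArg Subtype.val hQ
  rw [MvPolynomial.esymmAlgHom_apply] at hQ'
  refine ⟨Q, fun p hp => ?_⟩
  have eval_Q : MvPolynomial.eval
      (fun ℓ : Fin K =>
        MvPolynomial.eval p (MvPolynomial.esymm (Fin K) ℝ ((ℓ : ℕ) + 1))) Q =
      c * ∑ τ : Equiv.Perm (Fin K), MvPolynomial.eval (p ∘ τ) q := by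
    have h := congrArg (MvPolynomial.aeval p) hQ'
    rw [MvPolynomial.comp_aeval_apply] at h
    simpa only [MvPolynomial.aeval_eq_eval, RingHom.coe_coe, map_mul, map_sum, MvPolynomial.eval_C,
      MvPolynomial.eval_rename] using h
  have hdiff : f p - c * ∑ τ : Equiv.Perm (Fin K), MvPolynomial.eval (p ∘ τ) q =
      c * ∑ τ : Equiv.Perm (Fin K), (f (p ∘ τ) - MvPolynomial.eval (p ∘ τ) q) := by
    simp only [hsym, Finset.sum_sub_distrib, Finset.sum_const, Finset.card_univ, nsmul_eq_mul,
      mul_sub, c]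
    rw [inv_mul_cancel_left₀ hcard.ne']
  have hsum : ∑ τ : Equiv.Perm (Fin K), |f (p ∘ τ) - MvPolynomial.eval (p ∘ τ) q| <
      Fintype.card (Equiv.Perm (Fin K)) * ε := by
    rw [← nsmul_eq_mul, ← Finset.card_univ, ← Finset.sum_const]
    exact Finset.sum_lt_sum_of_nonempty Finset.univ_nonempty fun τ _ =>
      hq _ (Set.mem_iUnion.mpr ⟨τ, p, hp, rfl⟩)
  rw [eval_Q, hdiff, abs_mul, abs_of_pos (inv_pos.mpr hcard), inv_mul_lt_iff₀ hcard]
  exact (Finset.abs_sum_le_sum_abs _ _).trans_lt hsum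
end

section
/- Let X be a compact topological space and let A ⊆ C(X, ℝ) be a subalgebra of the continuous real-valued functions on X that contains the constant functions and separates points of X. Let K ≥ 1 and let p : X → ℝ^{K+1} be continuous with p_j(x) > 0 for all j and x and ∑_{j=0}^K p_j(x) = 1 for all x. Then for every ε > 0 there exist g₁, …, g_K ∈ A such that, setting g₀ ≡ 0, sup_{x ∈ X} max_{0 ≤ k ≤ K} | p_k(x) − exp(g_k(x)) / ∑_{j=0}^K exp(g_j(x)) | < ε. -/
theorem exp_div_sum_exp_le {ι : Type*} [Fintype ι] {f g : ι → ℝ} {δ : ℝ}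
    (h : ∀ j, |f j - g j| ≤ δ) (k : ι) :
    Real.exp (f k) / ∑ j, Real.exp (f j) ≤
      Real.exp (2 * δ) * (Real.exp (g k) / ∑ j, Real.exp (g j)) := by
  have : Nonempty ι := ⟨k⟩
  have hf : 0 < ∑ j, Real.exp (f j) :=
    Finset.sum_pos (fun _ _ => Real.exp_pos _) Finset.univ_nonempty
  have hg : 0 < ∑ j, Real.exp (g j) :=
    Finset.sum_pos (fun _ _ => Real.exp_pos _) Finset.univ_nonempty
  have hnum : Real.exp (f k) ≤ Real.exp δ * Real.exp (g k) := by
    rw [← Real.exp_add, Real.exp_le_exp]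
    linarith [(abs_le.mp (h k)).2]
  have hden : ∑ j, Real.exp (g j) ≤ Real.exp δ * ∑ j, Real.exp (f j) := by
    rw [Finset.mul_sum]
    refine Finset.sum_le_sum fun j _ => ?_
    rw [← Real.exp_add, Real.exp_le_exp]
    linarith [(abs_le.mp (h j)).1]
  rw [← mul_div_assoc, div_le_div_iff₀ hf hg, two_mul, Real.exp_add]
  calc Real.exp (f k) * ∑ j, Real.exp (g j)
      ≤ (Real.exp δ * Real.exp (g k)) * (Real.exp δ * ∑ j, Real.exp (f j)) := by gcongr
    _ = Real.exp δ * Real.exp δ * Real.exp (g k) * ∑ j, Real.exp (f j) := by ring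

theorem exp_div_sum_exp_le_one {ι : Type*} [Fintype ι] (f : ι → ℝ) (k : ι) :
    Real.exp (f k) / ∑ j, Real.exp (f j) ≤ 1 :=
  div_le_one_of_le₀
    (Finset.single_le_sum (f := fun j => Real.exp (f j)) (fun _ _ => (Real.exp_pos _).le)
      (Finset.mem_univ k))
    (Finset.sum_nonneg fun _ _ => (Real.exp_pos _).le)

theorem abs_exp_div_sum_exp_sub_le {ι : Type*} [Fintype ι] {f g : ι → ℝ} {δ : ℝ}
    (h : ∀ j, |f j - g j| ≤ δ) (k : ι) :
    |Real.exp (f k) / ∑ j, Real.exp (f j) - Real.exp (g k) / ∑ j, Real.exp (g j)| ≤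
      Real.exp (2 * δ) - 1 := by
  have hδ : 0 ≤ Real.exp (2 * δ) - 1 :=
    sub_nonneg.mpr (Real.one_le_exp (by linarith [(abs_nonneg _).trans (h k)]))
  have hfg := exp_div_sum_exp_le h k
  have hgf := exp_div_sum_exp_le (fun j => (abs_sub_comm (g j) (f j)).trans_le (h j)) k
  have hf := mul_le_mul_of_nonneg_left (exp_div_sum_exp_le_one f k) hδ
  have hg := mul_le_mul_of_nonneg_left (exp_div_sum_exp_le_one g k) hδ
  rw [abs_le]
  constructor <;> linarith

theorem exp_log_div_div_sum {ι : Type*} [Fintype ι] {q : ι → ℝ} (hq : ∀ j, 0 < q j)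
    (hsum : ∑ j, q j = 1) (i k : ι) :
    Real.exp (Real.log (q k / q i)) / ∑ j, Real.exp (Real.log (q j / q i)) = q k := by
  simp only [Real.exp_log (div_pos (hq _) (hq i)), ← Finset.sum_div, hsum]
  have := (hq i).ne'
  field_simp

/-- **Universal approximation of positive probability vectors by softmax of a
separating subalgebra.** On a compact space `X`, for any subalgebra `A ⊆ C(X, ℝ)`
separating points (and containing the constants, as every subalgebra does), any
continuous strictly positive probability vector `p` can be uniformly approximated
by the softmax of functions `g₁, …, g_K ∈ A` with `g₀ ≡ 0`. -/
theorem softmax_universal_approximation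
    (X : Type*) [TopologicalSpace X] [CompactSpace X]
    (A : Subalgebra ℝ C(X, ℝ)) (hA : A.SeparatesPoints)
    (K : ℕ) (hK : 1 ≤ K)
    (p : Fin (K + 1) → X → ℝ) (hpc : ∀ k, Continuous (p k))
    (hppos : ∀ k x, 0 < p k x) (hpsum : ∀ x, ∑ j, p j x = 1)
    (ε : ℝ) (hε : 0 < ε) :
    ∃ g : Fin (K + 1) → C(X, ℝ), g 0 = 0 ∧ (∀ k, g k ∈ A) ∧
      ∀ (x : X) (k : Fin (K + 1)),
        |p k x - Real.exp (g k x) / ∑ j, Real.exp (g j x)| < ε := by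
  set δ := Real.log (1 + ε / 2) / 2 with hδ
  have hδpos : 0 < δ := half_pos (Real.log_pos (by linarith))
  have hexp : Real.exp (2 * δ) - 1 < ε := by
    rw [hδ, mul_div_cancel₀ _ two_ne_zero, Real.exp_log (by linarith)]
    linarith
  have hcont : ∀ k, Continuous fun x => Real.log (p k x / p 0 x) := fun k =>
    ((hpc k).div (hpc 0) fun x => (hppos 0 x).ne').log
      fun x => (div_pos (hppos k x) (hppos 0 x)).ne'
  choose a ha using fun k =>
    ContinuousMap.exists_mem_subalgebra_near_continuous_of_separatesPoints A hA _ (hcont k) δ hδpos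
  refine ⟨fun k => if k = 0 then 0 else (a k : C(X, ℝ)), if_pos rfl, fun k => ?_, fun x k => ?_⟩
  · dsimp only
    split_ifs
    exacts [A.zero_mem, (a k).2]
  · have hclose : ∀ j, |Real.log (p j x / p 0 x) -
        (if j = 0 then 0 else (a j : C(X, ℝ)) : C(X, ℝ)) x| ≤ δ := by
      intro j
      split_ifs with hj
      · simp [hj, div_self (hppos 0 x).ne', hδpos.le]
      · rw [abs_sub_comm]
        exact (ha j x).le
    have key := abs_exp_div_sum_exp_sub_le hclose k
    rw [exp_log_div_div_sum (fun j => hppos j x) (hpsum x) 0 k] at key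
    exact key.trans_lt hexp
end
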